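/- arXiv:0808.0097 — 2 statements merged into one kernel-verified Lean document; each statement's English description precedes it below -/
import Mathlib

section
/- Cauchy's root-counting theorem: let F ∈ ℂ[Z] be a nonzero polynomial and Γ ⊂ ℂ a rectangle such that F does not vanish at any of the four vertices of Γ. Then ind_{∂Γ}(F) = Σ_{z ∈ Int Γ} m_z(F) + ½·Σ_{z ∈ ∂Γ} m_z(F), where m_z(F) denotes the multiplicity of z as a root of F; i.e. the algebraic index along ∂Γ counts the roots of F in Γ with multiplicity, roots on the boundary counting with half their multiplicity. -/
open Polynomial

/-- The value at `x` of the "unit part" of `P` after removing the factor `(X - x)^m`,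
where `m` is the multiplicity of `x` as a root of `P`. Nonzero whenever `P ≠ 0`. -/
noncomputable def unitEval (P : Polynomial ℝ) (x : ℝ) : ℝ :=
  (P /ₘ (X - C x) ^ rootMultiplicity x P).eval x

/-- One-sided Cauchy index `Ind_x^+` of the rational function `R/S` at `x`. -/
noncomputable def indPlus (R S : Polynomial ℝ) (x : ℝ) : ℝ :=
  if (rootMultiplicity x R : ℤ) < (rootMultiplicity x S : ℤ) then
    (1 / 2) * Real.sign (unitEval R x * unitEval S x)
  else 0

/-- One-sided Cauchy index `Ind_x^-` of the rational function `R/S` at `x`. -/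
noncomputable def indMinus (R S : Polynomial ℝ) (x : ℝ) : ℝ :=
  if (rootMultiplicity x R : ℤ) < (rootMultiplicity x S : ℤ) then
    (1 / 2) * (-1 : ℝ) ^ (rootMultiplicity x S - rootMultiplicity x R) *
      Real.sign (unitEval R x * unitEval S x)
  else 0

/-- Local Cauchy index `Ind_x(R/S) = Ind_x^+(R/S) - Ind_x^-(R/S)`. -/
noncomputable def indPoint (R S : Polynomial ℝ) (x : ℝ) : ℝ :=
  indPlus R S x - indMinus R S x

/-- The Cauchy index `Ind_a^b(R/S)` of the rational function `R/S` on `[a, b]`: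
`Ind_a^+(R/S) + Σ_{x ∈ (a,b)} Ind_x(R/S) - Ind_b^-(R/S)`, with the convention that
it is `0` when `R = 0` or `S = 0`.  (Only poles, i.e. roots of `S`, contribute to
the middle sum.) -/
noncomputable def cauchyIndex (R S : Polynomial ℝ) (a b : ℝ) : ℝ :=
  if R = 0 ∨ S = 0 then 0
  else indPlus R S a +
      (∑ x ∈ S.roots.toFinset, if a < x ∧ x < b then indPoint R S x else 0) -
      indMinus R S b

/-- Number of sign changes `V(s_0, …, s_n) = Σ ½|sign s_{k-1} - sign s_k|` of a list of reals. -/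
noncomputable def signVar : List ℝ → ℝ
  | [] => 0
  | [_] => 0
  | a :: b :: l => (1 / 2) * |Real.sign a - Real.sign b| + signVar (b :: l)

/-- Sign changes `V_x(S_0, …, S_n)` of a list of real polynomials evaluated at `x`. -/
noncomputable def signVarAt (L : List (Polynomial ℝ)) (x : ℝ) : ℝ :=
  signVar (L.map fun P => P.eval x)

/-- Real part of a complex polynomial, coefficientwise. -/
noncomputable def rePoly (p : Polynomial ℂ) : Polynomial ℝ :=
  p.sum fun n c => Polynomial.C c.re * Polynomial.X ^ n

/-- Imaginary part of a complex polynomial, coefficientwise. -/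
noncomputable def imPoly (p : Polynomial ℂ) : Polynomial ℝ :=
  p.sum fun n c => Polynomial.C c.im * Polynomial.X ^ n

/-- For `F ∈ ℂ[Z]`, the one-variable polynomial `F̂(t) = F(a + t(b - a))` obtained by
substituting the affine parametrization of the segment from `a` to `b` (this is the
substitution `Z = X + iY` followed by the parametrization of the segment). -/
noncomputable def segPolyC (F : Polynomial ℂ) (a b : ℂ) : Polynomial ℂ :=
  F.comp (Polynomial.C a + Polynomial.C (b - a) * Polynomial.X)

/-- The index `ind_{[a,b]}(F) = ½ · Ind_0^1(re F̂ / im F̂)` of `F ∈ ℂ[Z]` along the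
segment from `a` to `b`. -/
noncomputable def segIndexC (F : Polynomial ℂ) (a b : ℂ) : ℝ :=
  (1 / 2) * cauchyIndex (rePoly (segPolyC F a b)) (imPoly (segPolyC F a b)) 0 1

/-- The algebraic index `ind_{∂Γ}(F)` of `F ∈ ℂ[Z]` along the positively oriented
boundary of the rectangle `Γ = [x₀,x₁] × [y₀,y₁] ⊂ ℂ` with vertices
`a = x₀ + iy₀`, `b = x₁ + iy₀`, `c = x₁ + iy₁`, `d = x₀ + iy₁`. -/
noncomputable def rectIndexC (F : Polynomial ℂ) (x₀ x₁ y₀ y₁ : ℝ) : ℝ :=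
  segIndexC F (x₀ + y₀ * Complex.I) (x₁ + y₀ * Complex.I) +
  segIndexC F (x₁ + y₀ * Complex.I) (x₁ + y₁ * Complex.I) +
  segIndexC F (x₁ + y₁ * Complex.I) (x₀ + y₁ * Complex.I) +
  segIndexC F (x₀ + y₁ * Complex.I) (x₀ + y₀ * Complex.I)

section

open Filter Topology Set

/-- A function on `(a, b)` which is locally constant off a finite set varies by the sum of its
jumps; `r` and `l` are its right and left limits. -/
theorem sub_eq_sum_jumps {f r l : ℝ → ℝ} (T : Finset ℝ) {a b : ℝ} (hab : a < b)
    (hf : ∀ x ∈ Ioo a b, x ∉ T → HasDerivAt f 0 x)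
    (hr : ∀ x ∈ Ico a b, Tendsto f (𝓝[>] x) (𝓝 (r x)))
    (hl : ∀ x ∈ Ioc a b, Tendsto f (𝓝[<] x) (𝓝 (l x))) :
    l b - r a = ∑ x ∈ T, if a < x ∧ x < b then r x - l x else 0 := by
  induction T using Finset.induction_on generalizing a b with
  | empty =>
    have hle : ∀ x ∈ Ioo a b, ∀ y ∈ Ioo a b, x ≤ y → f y = f x := by
      intro x hx y hy hxy
      refine constant_of_has_deriv_right_zero
        (fun z hz => (hf z ⟨hx.1.trans_le hz.1, hz.2.trans_lt hy.2⟩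
          (by simp)).continuousAt.continuousWithinAt)
        (fun z hz => (hf z ⟨hx.1.trans_le hz.1, hz.2.trans hy.2⟩
          (by simp)).hasDerivWithinAt) y ⟨hxy, le_rfl⟩
    have hm : (a + b) / 2 ∈ Ioo a b := ⟨by linarith, by linarith⟩
    have hconst : ∀ x ∈ Ioo a b, f x = f ((a + b) / 2) := by
      intro x hx
      rcases le_total x ((a + b) / 2) with h | h
      · exact (hle x hx _ hm h).symm
      · exact hle _ hm x hx h
    have hra : r a = f ((a + b) / 2) := by
      refine tendsto_nhds_unique (hr a ⟨le_rfl, hab⟩) (tendsto_const_nhds.congr' ?_)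
      filter_upwards [Ioo_mem_nhdsGT hab] with x hx using (hconst x hx).symm
    have hlb : l b = f ((a + b) / 2) := by
      refine tendsto_nhds_unique (hl b ⟨hab, le_rfl⟩) (tendsto_const_nhds.congr' ?_)
      filter_upwards [Ioo_mem_nhdsLT hab] with x hx using (hconst x hx).symm
    simp [hra, hlb]
  | insert c T hc ih =>
    rw [Finset.sum_insert hc]
    by_cases hcab : a < c ∧ c < b
    · obtain ⟨hac, hcb⟩ := hcab
      have h₁ := ih hac (fun x hx hxT => hf x ⟨hx.1, hx.2.trans hcb⟩ (by
          simp only [Finset.mem_insert, not_or]; exact ⟨hx.2.ne, hxT⟩))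
        (fun x hx => hr x ⟨hx.1, hx.2.trans hcb⟩) (fun x hx => hl x ⟨hx.1, hx.2.trans hcb.le⟩)
      have h₂ := ih hcb (fun x hx hxT => hf x ⟨hac.trans hx.1, hx.2⟩ (by
          simp only [Finset.mem_insert, not_or]; exact ⟨hx.1.ne', hxT⟩))
        (fun x hx => hr x ⟨hac.le.trans hx.1, hx.2⟩) (fun x hx => hl x ⟨hac.trans hx.1, hx.2⟩)
      have hsplit : (∑ x ∈ T, if a < x ∧ x < b then r x - l x else 0) =
          (∑ x ∈ T, if a < x ∧ x < c then r x - l x else 0) +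
            ∑ x ∈ T, if c < x ∧ x < b then r x - l x else 0 := by
        rw [← Finset.sum_add_distrib]
        refine Finset.sum_congr rfl fun x hx => ?_
        have hxc : x ≠ c := fun h => hc (h ▸ hx)
        rcases lt_or_gt_of_ne hxc with h | h
        · simp [h, h.trans hcb, h.not_gt]
        · simp [h, hac.trans h, h.not_gt]
      rw [if_pos ⟨hac, hcb⟩, hsplit, ← h₁, ← h₂]
      ring
    · rw [if_neg hcab, zero_add]
      refine ih hab (fun x hx hxT => hf x hx ?_) hr hl
      simp only [Finset.mem_insert, not_or]
      exact ⟨fun h => hcab (h ▸ hx), hxT⟩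

theorem tendsto_arctan_div_of_tendsto_zero {ι : Type*} {L : Filter ι} {h d : ι → ℝ} {c : ℝ}
    (hc : c ≠ 0) (hh : Tendsto h L (𝓝 c)) (hd : Tendsto d L (𝓝[>] 0)) :
    Tendsto (fun t => Real.arctan (h t / d t)) L (𝓝 (Real.pi / 2 * Real.sign c)) := by
  have hinv : Tendsto (fun t => (d t)⁻¹) L atTop := tendsto_inv_nhdsGT_zero.comp hd
  simp only [div_eq_mul_inv (h _)]
  rcases lt_or_gt_of_ne hc with hc | hc
  · rw [Real.sign_of_neg hc, mul_neg_one]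
    exact (Real.tendsto_arctan_atBot.mono_right nhdsWithin_le_nhds).comp
      (hh.neg_mul_atTop hc hinv)
  · rw [Real.sign_of_pos hc, mul_one]
    exact (Real.tendsto_arctan_atTop.mono_right nhdsWithin_le_nhds).comp
      (hh.pos_mul_atTop hc hinv)

theorem tendsto_pow_mul_sq_nhdsGT_zero {u g : ℝ → ℝ} {L : Filter ℝ} {c : ℝ} {k : ℕ} (hk : k ≠ 0)
    (hc : c ≠ 0) (hu : Tendsto u L (𝓝[>] 0)) (hg : Tendsto g L (𝓝 c)) :
    Tendsto (fun t => u t ^ k * g t ^ 2) L (𝓝[>] 0) := by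
  rw [tendsto_nhdsWithin_iff] at hu ⊢
  refine ⟨by simpa [hk] using (hu.1.pow k).mul (hg.pow 2), ?_⟩
  filter_upwards [hu.2, hg.eventually_ne hc] with t h₁ h₂
  have h₁ : 0 < u t := h₁
  exact mem_Ioi.2 (by positivity)

theorem eval_eq_pow_mul_eval_divByMonic (P : ℝ[X]) (x t : ℝ) :
    P.eval t = (t - x) ^ rootMultiplicity x P *
      (P /ₘ (X - C x) ^ rootMultiplicity x P).eval t := by
  conv_lhs => rw [← pow_mul_divByMonic_rootMultiplicity_eq P x]
  simp

theorem sign_neg_one_pow_mul (k : ℕ) (y : ℝ) :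
    Real.sign ((-1) ^ k * y) = (-1) ^ k * Real.sign y := by
  rcases neg_one_pow_eq_or ℝ k with h | h <;> simp [h, Real.sign_neg]

/-- Near `x`, `arctan (R / S)` has one-sided limits, which differ from the Cauchy indices of
`R / S` at `x`, scaled by `π`, by a common constant. -/
theorem exists_tendsto_arctan_div (R S : ℝ[X]) (hS : S ≠ 0) (x : ℝ) :
    ∃ c : ℝ,
      Tendsto (fun t => Real.arctan (R.eval t / S.eval t)) (𝓝[>] x)
        (𝓝 (Real.pi * indPlus R S x + c)) ∧
      Tendsto (fun t => Real.arctan (R.eval t / S.eval t)) (𝓝[<] x)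
        (𝓝 (Real.pi * indMinus R S x + c)) ∧
      (R.eval x ≠ 0 ∨ S.eval x ≠ 0 → c = Real.arctan (R.eval x / S.eval x)) := by
  rcases eq_or_ne R 0 with rfl | hR
  · exact ⟨0, by simp [indPlus, unitEval], by simp [indMinus, unitEval], by simp⟩
  have hR₁ := eval_divByMonic_pow_rootMultiplicity_ne_zero x hR
  have hS₁ := eval_divByMonic_pow_rootMultiplicity_ne_zero x hS
  have hRt := eval_eq_pow_mul_eval_divByMonic R x
  have hSt := eval_eq_pow_mul_eval_divByMonic S x
  unfold indPlus indMinus unitEval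
  set m := rootMultiplicity x R
  set n := rootMultiplicity x S
  set R₁ := R /ₘ (X - C x) ^ m
  set S₁ := S /ₘ (X - C x) ^ n
  have hRS : R₁.eval x * S₁.eval x ≠ 0 := mul_ne_zero hR₁ hS₁
  have hS₁n : ∀ᶠ t in 𝓝 x, S₁.eval t ≠ 0 := S₁.continuous.continuousAt.eventually_ne hS₁
  have hmul : Tendsto (fun t => R₁.eval t * S₁.eval t) (𝓝 x) (𝓝 (R₁.eval x * S₁.eval x)) :=
    (R₁.continuous.mul S₁.continuous).tendsto x
  rcases lt_or_ge m n with hmn | hmn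
  · have hmn' : (m : ℤ) < n := by exact_mod_cast hmn
    have hk : n - m ≠ 0 := by omega
    have hn : n ≠ 0 := by omega
    simp only [if_pos hmn']
    refine ⟨0, ?_, ?_, fun _ => by simp [hSt, hn]⟩
    · have hu : Tendsto (fun t => t - x) (𝓝[>] x) (𝓝[>] 0) := by
        refine tendsto_nhdsWithin_iff.2 ⟨?_, ?_⟩
        · have : Tendsto (fun t => t - x) (𝓝 x) (𝓝 (x - x)) := tendsto_id.sub_const x
          exact (sub_self x ▸ this).mono_left nhdsWithin_le_nhds
        · filter_upwards [self_mem_nhdsWithin] with t ht using mem_Ioi.2 (sub_pos.2 ht)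
      have := tendsto_arctan_div_of_tendsto_zero hRS (hmul.mono_left nhdsWithin_le_nhds)
        (tendsto_pow_mul_sq_nhdsGT_zero hk hS₁ hu
          ((S₁.continuous.tendsto x).mono_left nhdsWithin_le_nhds))
      rw [show Real.pi * (1 / 2 * Real.sign (R₁.eval x * S₁.eval x)) + 0 =
        Real.pi / 2 * Real.sign (R₁.eval x * S₁.eval x) by ring]
      refine this.congr' ?_
      filter_upwards [self_mem_nhdsWithin, hS₁n.filter_mono nhdsWithin_le_nhds] with t ht h₁
      have ht : t - x ≠ 0 := (sub_pos.2 ht).ne'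
      congr 1
      rw [hRt, hSt, show n = m + (n - m) by omega, pow_add, Nat.add_sub_cancel_left]
      field_simp
    · have hu : Tendsto (fun t => x - t) (𝓝[<] x) (𝓝[>] 0) := by
        refine tendsto_nhdsWithin_iff.2 ⟨?_, ?_⟩
        · have : Tendsto (fun t => x - t) (𝓝 x) (𝓝 (x - x)) := tendsto_id.const_sub x
          exact (sub_self x ▸ this).mono_left nhdsWithin_le_nhds
        · filter_upwards [self_mem_nhdsWithin] with t ht using mem_Ioi.2 (sub_pos.2 ht)
      have := tendsto_arctan_div_of_tendsto_zero
        (mul_ne_zero (pow_ne_zero (n - m) (neg_ne_zero.2 one_ne_zero)) hRS)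
        ((hmul.const_mul ((-1) ^ (n - m))).mono_left nhdsWithin_le_nhds)
        (tendsto_pow_mul_sq_nhdsGT_zero hk hS₁ hu
          ((S₁.continuous.tendsto x).mono_left nhdsWithin_le_nhds))
      rw [sign_neg_one_pow_mul] at this
      rw [show Real.pi * (1 / 2 * (-1) ^ (n - m) * Real.sign (R₁.eval x * S₁.eval x)) + 0 =
        Real.pi / 2 * ((-1) ^ (n - m) * Real.sign (R₁.eval x * S₁.eval x)) by ring]
      refine this.congr' ?_
      filter_upwards [self_mem_nhdsWithin, hS₁n.filter_mono nhdsWithin_le_nhds] with t ht h₁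
      have ht : x - t ≠ 0 := (sub_pos.2 ht).ne'
      have ht' : t - x = -1 * (x - t) := by ring
      have hsq : ((-1 : ℝ) ^ (n - m)) ^ 2 = 1 := by rw [← pow_mul, mul_comm, pow_mul]; simp
      congr 1
      rw [hRt, hSt, show n = m + (n - m) by omega, pow_add, Nat.add_sub_cancel_left, ht',
        mul_pow, mul_pow]
      have hsn : (-1 : ℝ) ^ (n - m) ≠ 0 := pow_ne_zero _ (by norm_num)
      have hsm : (-1 : ℝ) ^ m ≠ 0 := pow_ne_zero _ (by norm_num)
      generalize (-1 : ℝ) ^ (n - m) = e at *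
      field_simp
      linear_combination (eval t R₁) * hsq
  · have hmn' : ¬ (m : ℤ) < n := by exact_mod_cast hmn.not_gt
    simp only [if_neg hmn', mul_zero, zero_add]
    have hlim : Tendsto (fun t => Real.arctan ((t - x) ^ (m - n) * R₁.eval t / S₁.eval t)) (𝓝 x)
        (𝓝 (Real.arctan ((x - x) ^ (m - n) * R₁.eval x / S₁.eval x))) := by
      refine (Real.continuous_arctan.tendsto _).comp (Tendsto.div ?_ (S₁.continuous.tendsto x) hS₁)
      exact ContinuousAt.tendsto (f := fun t => (t - x) ^ (m - n) * R₁.eval t) (by fun_prop)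
    have heq : ∀ t, t ≠ x → Real.arctan ((t - x) ^ (m - n) * R₁.eval t / S₁.eval t) =
        Real.arctan (R.eval t / S.eval t) := by
      intro t ht
      have ht : t - x ≠ 0 := sub_ne_zero.2 ht
      rw [hRt, hSt, ← Nat.add_sub_cancel' hmn, pow_add, Nat.add_sub_cancel_left, mul_assoc,
        mul_div_mul_left _ _ (pow_ne_zero _ ht)]
    refine ⟨_, (hlim.mono_left nhdsWithin_le_nhds).congr' ?_,
      (hlim.mono_left nhdsWithin_le_nhds).congr' ?_, fun h => ?_⟩
    · filter_upwards [self_mem_nhdsWithin] with t ht using heq t (ne_of_gt ht)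
    · filter_upwards [self_mem_nhdsWithin] with t ht using heq t (ne_of_lt ht)
    · have hn : n = 0 := by
        by_contra hn
        have hm : m ≠ 0 := by omega
        simp [hRt x, hSt x, hm, hn] at h
      rw [hRt x, hSt x, hn]
      simp

/-- If `θ` is a continuous argument of `R + iS` up to constants, then the Cauchy index of `R / S`
is the variation of `θ` up to boundary terms. -/
theorem pi_mul_cauchyIndex (R S : ℝ[X]) (θ : ℝ → ℝ) {a b : ℝ} (hab : a < b) (hθ : Continuous θ)
    (hderiv : ∀ t, R.eval t ≠ 0 ∨ S.eval t ≠ 0 → HasDerivAt θ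
      ((R.eval t * S.derivative.eval t - R.derivative.eval t * S.eval t) /
        (R.eval t ^ 2 + S.eval t ^ 2)) t)
    (ha : R.eval a ≠ 0 ∨ S.eval a ≠ 0) (hb : R.eval b ≠ 0 ∨ S.eval b ≠ 0) :
    Real.pi * cauchyIndex R S a b =
      (θ b + Real.arctan (R.eval b / S.eval b)) - (θ a + Real.arctan (R.eval a / S.eval a)) := by
  rcases eq_or_ne S 0 with rfl | hS
  · have hR : R ≠ 0 := by rintro rfl; simp at ha
    have := sub_eq_sum_jumps (f := θ) (r := θ) (l := θ) R.roots.toFinset hab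
      (fun x _ hx => by
        have hx : R.eval x ≠ 0 := by simpa [hR] using hx
        simpa using hderiv x (Or.inl hx))
      (fun x _ => (hθ.tendsto x).mono_left nhdsWithin_le_nhds)
      (fun x _ => (hθ.tendsto x).mono_left nhdsWithin_le_nhds)
    simpa [cauchyIndex, eq_comm] using this
  choose c hcr hcl hc using exists_tendsto_arctan_div R S hS
  have key := sub_eq_sum_jumps (f := fun t => θ t + Real.arctan (R.eval t / S.eval t))
    (r := fun x => θ x + (Real.pi * indPlus R S x + c x))
    (l := fun x => θ x + (Real.pi * indMinus R S x + c x)) S.roots.toFinset hab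
    (fun x _ hx => by
      have hx : S.eval x ≠ 0 := by simpa [hS] using hx
      have h := (hderiv x (Or.inr hx)).add (((R.hasDerivAt x).div (S.hasDerivAt x) hx).arctan)
      refine h.congr_deriv ?_
      simp only [Pi.div_apply]
      have h₁ : R.eval x ^ 2 + S.eval x ^ 2 ≠ 0 := by positivity
      have h₂ : 1 + (R.eval x / S.eval x) ^ 2 ≠ 0 := by positivity
      field_simp
      ring)
    (fun x _ => ((hθ.tendsto x).mono_left nhdsWithin_le_nhds).add (hcr x))
    (fun x _ => ((hθ.tendsto x).mono_left nhdsWithin_le_nhds).add (hcl x))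
  rw [← hc a ha, ← hc b hb]
  have hsum : (∑ x ∈ S.roots.toFinset, if a < x ∧ x < b then
      θ x + (Real.pi * indPlus R S x + c x) - (θ x + (Real.pi * indMinus R S x + c x)) else 0) =
      Real.pi * ∑ x ∈ S.roots.toFinset, if a < x ∧ x < b then indPoint R S x else 0 := by
    rw [Finset.mul_sum]
    refine Finset.sum_congr rfl fun x _ => ?_
    split_ifs
    · unfold indPoint; ring
    · ring
  have hR : Real.pi * cauchyIndex R S a b = Real.pi * (indPlus R S a +
      (∑ x ∈ S.roots.toFinset, if a < x ∧ x < b then indPoint R S x else 0) -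
      indMinus R S b) := by
    rcases eq_or_ne R 0 with rfl | hR
    · simp [cauchyIndex, indPlus, indMinus, indPoint, unitEval]
    · simp [cauchyIndex, hR, hS]
  rw [hR]
  rw [hsum] at key
  linear_combination -key

theorem eval_rePoly (p : ℂ[X]) (t : ℝ) : (rePoly p).eval t = (p.eval (t : ℂ)).re := by
  rw [rePoly, Polynomial.sum_def, eval_finsetSum, eval_eq_sum, Polynomial.sum_def, Complex.re_sum]
  refine Finset.sum_congr rfl fun n _ => ?_
  rw [← Complex.ofReal_pow, Complex.re_mul_ofReal]
  simp

theorem eval_imPoly (p : ℂ[X]) (t : ℝ) : (imPoly p).eval t = (p.eval (t : ℂ)).im := by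
  rw [imPoly, Polynomial.sum_def, eval_finsetSum, eval_eq_sum, Polynomial.sum_def, Complex.im_sum]
  refine Finset.sum_congr rfl fun n _ => ?_
  rw [← Complex.ofReal_pow, Complex.im_mul_ofReal]
  simp

theorem eval_derivative_rePoly (p : ℂ[X]) (t : ℝ) :
    (rePoly p).derivative.eval t = (p.derivative.eval (t : ℂ)).re := by
  refine ((rePoly p).hasDerivAt t).unique ?_
  have h := Complex.reCLM.hasFDerivAt.comp_hasDerivAt t (p.hasDerivAt (t : ℂ)).comp_ofReal
  exact h.congr_of_eventuallyEq (Eventually.of_forall fun s => eval_rePoly p s)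

theorem eval_derivative_imPoly (p : ℂ[X]) (t : ℝ) :
    (imPoly p).derivative.eval t = (p.derivative.eval (t : ℂ)).im := by
  refine ((imPoly p).hasDerivAt t).unique ?_
  have h := Complex.imCLM.hasFDerivAt.comp_hasDerivAt t (p.hasDerivAt (t : ℂ)).comp_ofReal
  exact h.congr_of_eventuallyEq (Eventually.of_forall fun s => eval_imPoly p s)

/-- Up to a constant, `arctan ((t - re w) / im w)` is a continuous argument of `t - w`. -/
theorem hasDerivAt_arctan_sub_div (w : ℂ) (t : ℝ) :
    HasDerivAt (fun s : ℝ => Real.arctan ((s - w.re) / w.im)) (1 / ((t : ℂ) - w)).im t := by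
  have him : (1 / ((t : ℂ) - w)).im = w.im / ((t - w.re) ^ 2 + w.im ^ 2) := by
    rw [one_div, Complex.inv_im, Complex.normSq_apply]
    simp [sq]
  rw [him]
  rcases eq_or_ne w.im 0 with hv | hv
  · simpa [hv] using hasDerivAt_const t (0 : ℝ)
  · refine (((hasDerivAt_id t).sub_const w.re).div_const w.im).arctan.congr_deriv ?_
    have h₁ : 1 + ((t - w.re) / w.im) ^ 2 ≠ 0 := by positivity
    have h₂ : (t - w.re) ^ 2 + w.im ^ 2 ≠ 0 := by positivity
    simp only [id]
    field_simp
    ring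

/-- Up to a constant, a continuous argument of `F` along the segment from `a` to `b`. -/
noncomputable def segArg (F : ℂ[X]) (a b : ℂ) (t : ℝ) : ℝ :=
  ∑ z ∈ F.roots.toFinset, (rootMultiplicity z F : ℝ) *
    Real.arctan ((t - ((z - a) / (b - a)).re) / ((z - a) / (b - a)).im)

theorem continuous_segArg (F : ℂ[X]) (a b : ℂ) : Continuous (segArg F a b) := by
  refine continuous_finsetSum _ fun z _ => continuous_const.mul ?_
  exact Real.continuous_arctan.comp ((continuous_id.sub continuous_const).div_const _)

theorem eval_segPolyC (F : ℂ[X]) (a b w : ℂ) :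
    (segPolyC F a b).eval w = F.eval (a + (b - a) * w) := by
  simp [segPolyC]

theorem eval_derivative_segPolyC (F : ℂ[X]) (a b w : ℂ) :
    (segPolyC F a b).derivative.eval w = (b - a) * F.derivative.eval (a + (b - a) * w) := by
  simp [segPolyC, derivative_comp]

theorem hasDerivAt_segArg (F : ℂ[X]) {a b : ℂ} (hab : a ≠ b) {t : ℝ}
    (ht : (segPolyC F a b).eval (t : ℂ) ≠ 0) :
    HasDerivAt (segArg F a b)
      ((segPolyC F a b).derivative.eval (t : ℂ) / (segPolyC F a b).eval (t : ℂ)).im t := by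
  have hba : b - a ≠ 0 := sub_ne_zero.2 hab.symm
  have h : HasDerivAt (segArg F a b) (∑ z ∈ F.roots.toFinset, (rootMultiplicity z F : ℝ) *
      (1 / ((t : ℂ) - (z - a) / (b - a))).im) t :=
    HasDerivAt.fun_sum fun z _ => (hasDerivAt_arctan_sub_div _ t).const_mul _
  refine h.congr_deriv ?_
  rw [eval_segPolyC] at ht
  rw [eval_segPolyC, eval_derivative_segPolyC, mul_div_assoc,
    (IsAlgClosed.splits F).eval_derivative_div_eval_of_ne_zero ht,
    Finset.sum_multiset_map_count, Finset.mul_sum, Complex.im_sum]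
  refine Finset.sum_congr rfl fun z hz => ?_
  have hz : F.eval z = 0 := (mem_roots'.1 (Multiset.mem_toFinset.1 hz)).2
  have h₁ : a + (b - a) * t - z ≠ 0 := fun h => ht (by rw [sub_eq_zero.1 h, hz])
  have h₂ : (b - a) * (1 / (a + (b - a) * t - z)) = 1 / ((t : ℂ) - (z - a) / (b - a)) := by
    rw [show (t : ℂ) - (z - a) / (b - a) = (a + (b - a) * t - z) / (b - a) by
      field_simp; ring]
    field_simp
  rw [count_roots, nsmul_eq_mul, mul_left_comm, h₂, ← Complex.ofReal_natCast,
    Complex.im_ofReal_mul]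

theorem two_pi_mul_segIndexC (F : ℂ[X]) {a b : ℂ} (hab : a ≠ b) (ha : F.eval a ≠ 0)
    (hb : F.eval b ≠ 0) :
    2 * Real.pi * segIndexC F a b =
      (∑ z ∈ F.roots.toFinset, (rootMultiplicity z F : ℝ) *
        (Real.arctan ((1 - ((z - a) / (b - a)).re) / ((z - a) / (b - a)).im) +
          Real.arctan (((z - a) / (b - a)).re / ((z - a) / (b - a)).im))) +
      (Real.arctan ((F.eval b).re / (F.eval b).im) -
        Real.arctan ((F.eval a).re / (F.eval a).im)) := by
  have hne (z : ℂ) : z.re ≠ 0 ∨ z.im ≠ 0 ↔ z ≠ 0 := by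
    rw [ne_eq z, Complex.ext_iff, not_and_or]; rfl
  have key := pi_mul_cauchyIndex (rePoly (segPolyC F a b)) (imPoly (segPolyC F a b))
    (segArg F a b) one_pos (continuous_segArg F a b)
    (fun t ht => by
      rw [eval_rePoly, eval_imPoly, hne] at ht
      refine (hasDerivAt_segArg F hab ht).congr_deriv ?_
      rw [eval_rePoly, eval_imPoly, eval_derivative_rePoly, eval_derivative_imPoly,
        Complex.div_im, Complex.normSq_apply]
      ring)
    (by rw [eval_rePoly, eval_imPoly, hne, eval_segPolyC]; simpa using ha)
    (by rw [eval_rePoly, eval_imPoly, hne, eval_segPolyC]; simpa using hb)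
  simp only [eval_rePoly, eval_imPoly, eval_segPolyC, Complex.ofReal_zero, Complex.ofReal_one,
    mul_zero, mul_one, add_zero, add_sub_cancel] at key
  have hθ : segArg F a b 1 - segArg F a b 0 = ∑ z ∈ F.roots.toFinset, (rootMultiplicity z F : ℝ) *
        (Real.arctan ((1 - ((z - a) / (b - a)).re) / ((z - a) / (b - a)).im) +
          Real.arctan (((z - a) / (b - a)).re / ((z - a) / (b - a)).im)) := by
    rw [segArg, segArg, ← Finset.sum_sub_distrib]
    refine Finset.sum_congr rfl fun z _ => ?_
    rw [zero_sub, neg_div, Real.arctan_neg]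
    ring
  rw [← hθ, segIndexC]
  linear_combination key

theorem sub_div_horizontal (x x' y : ℝ) (z : ℂ) :
    (z - (x + y * Complex.I)) / ((x' + y * Complex.I) - (x + y * Complex.I)) =
      ⟨(z.re - x) / (x' - x), (z.im - y) / (x' - x)⟩ := by
  rw [show ((x' : ℂ) + y * Complex.I) - (x + y * Complex.I) = ((x' - x : ℝ) : ℂ) by
    push_cast; ring]
  apply Complex.ext
  · rw [Complex.div_ofReal_re]; simp
  · rw [Complex.div_ofReal_im]; simp

theorem sub_div_vertical (x y y' : ℝ) (z : ℂ) :
    (z - (x + y * Complex.I)) / ((x + y' * Complex.I) - (x + y * Complex.I)) =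
      ⟨(z.im - y) / (y' - y), (x - z.re) / (y' - y)⟩ := by
  have h : (z - (x + y * Complex.I)) / ((x + y' * Complex.I) - (x + y * Complex.I)) =
      (-Complex.I * (z - (x + y * Complex.I))) / ((y' - y : ℝ) : ℂ) := by
    rw [show ((x : ℂ) + y' * Complex.I) - (x + y * Complex.I) =
      Complex.I * ((y' - y : ℝ) : ℂ) by push_cast; ring, div_mul_eq_div_div, Complex.div_I]
    ring
  rw [h]
  apply Complex.ext
  · rw [Complex.div_ofReal_re]; simp
  · rw [Complex.div_ofReal_im]; simp

theorem one_sub_div_div_div {p L : ℝ} (r : ℝ) (hL : L ≠ 0) :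
    (1 - p / L) / (r / L) = (L - p) / r := by
  rw [show 1 - p / L = (L - p) / L by field_simp, div_div_div_cancel_right₀ hL]

theorem two_pi_mul_segIndexC_horizontal (F : ℂ[X]) {x x' y : ℝ} (hx : x ≠ x')
    (ha : F.eval (x + y * Complex.I) ≠ 0) (hb : F.eval (x' + y * Complex.I) ≠ 0) :
    2 * Real.pi * segIndexC F (x + y * Complex.I) (x' + y * Complex.I) =
      (∑ z ∈ F.roots.toFinset, (rootMultiplicity z F : ℝ) *
        (Real.arctan ((x' - z.re) / (z.im - y)) + Real.arctan ((z.re - x) / (z.im - y)))) +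
      (Real.arctan ((F.eval (x' + y * Complex.I)).re / (F.eval (x' + y * Complex.I)).im) -
        Real.arctan ((F.eval (x + y * Complex.I)).re / (F.eval (x + y * Complex.I)).im)) := by
  have hL : x' - x ≠ 0 := sub_ne_zero.2 hx.symm
  rw [two_pi_mul_segIndexC F (fun h => hx (by simpa using h)) ha hb]
  congr 1
  refine Finset.sum_congr rfl fun z _ => ?_
  rw [sub_div_horizontal]
  simp only [one_sub_div_div_div _ hL, div_div_div_cancel_right₀ hL, sub_sub_sub_cancel_right]

theorem two_pi_mul_segIndexC_vertical (F : ℂ[X]) {x y y' : ℝ} (hy : y ≠ y')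
    (ha : F.eval (x + y * Complex.I) ≠ 0) (hb : F.eval (x + y' * Complex.I) ≠ 0) :
    2 * Real.pi * segIndexC F (x + y * Complex.I) (x + y' * Complex.I) =
      (∑ z ∈ F.roots.toFinset, (rootMultiplicity z F : ℝ) *
        (Real.arctan ((y' - z.im) / (x - z.re)) + Real.arctan ((z.im - y) / (x - z.re)))) +
      (Real.arctan ((F.eval (x + y' * Complex.I)).re / (F.eval (x + y' * Complex.I)).im) -
        Real.arctan ((F.eval (x + y * Complex.I)).re / (F.eval (x + y * Complex.I)).im)) := by
  have hL : y' - y ≠ 0 := sub_ne_zero.2 hy.symm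
  rw [two_pi_mul_segIndexC F (fun h => hy (by simpa using h)) ha hb]
  congr 1
  refine Finset.sum_congr rfl fun z _ => ?_
  rw [sub_div_vertical]
  simp only [one_sub_div_div_div _ hL, div_div_div_cancel_right₀ hL, sub_sub_sub_cancel_right]

theorem arctan_div_add_arctan_div_swap (x y : ℝ) :
    Real.arctan (x / y) + Real.arctan (y / x) =
      Real.pi / 2 * (Real.sign x * Real.sign y) := by
  rw [← inv_div x y]
  rcases lt_trichotomy x 0 with hx | rfl | hx <;> rcases lt_trichotomy y 0 with hy | rfl | hy
  · rw [Real.arctan_inv_of_pos (div_pos_of_neg_of_neg hx hy), Real.sign_of_neg hx,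
      Real.sign_of_neg hy]; ring
  · simp
  · rw [Real.arctan_inv_of_neg (div_neg_of_neg_of_pos hx hy), Real.sign_of_neg hx,
      Real.sign_of_pos hy]; ring
  · simp
  · simp
  · simp
  · rw [Real.arctan_inv_of_neg (div_neg_of_pos_of_neg hx hy), Real.sign_of_pos hx,
      Real.sign_of_neg hy]; ring
  · simp
  · rw [Real.arctan_inv_of_pos (div_pos hx hy), Real.sign_of_pos hx, Real.sign_of_pos hy]; ring

/-- The total variation of the argument along the boundary of a rectangle, as seen from a point
with signed distances `p`, `q`, `r`, `s` to the left, right, bottom and top sides. -/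
theorem sum_arctan_div (p q r s : ℝ) :
    (Real.arctan (q / r) + Real.arctan (p / r)) + (Real.arctan (s / q) + Real.arctan (r / q)) +
      (Real.arctan (p / s) + Real.arctan (q / s)) + (Real.arctan (r / p) + Real.arctan (s / p)) =
      Real.pi / 2 * ((Real.sign p + Real.sign q) * (Real.sign r + Real.sign s)) := by
  linear_combination arctan_div_add_arctan_div_swap p r + arctan_div_add_arctan_div_swap p s +
    arctan_div_add_arctan_div_swap q r + arctan_div_add_arctan_div_swap q s

theorem sign_add_sign_eq {x₀ x₁ : ℝ} (hx : x₀ < x₁) (x : ℝ) :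
    Real.sign (x - x₀) + Real.sign (x₁ - x) =
      if x₀ < x ∧ x < x₁ then 2 else if x = x₀ ∨ x = x₁ then 1 else 0 := by
  rcases lt_trichotomy x x₀ with h | rfl | h
  · rw [Real.sign_of_neg (sub_neg.2 h), Real.sign_of_pos (sub_pos.2 (h.trans hx)),
      if_neg (fun h' => h.not_gt h'.1), if_neg (not_or.2 ⟨h.ne, (h.trans hx).ne⟩)]
    norm_num
  · simp [Real.sign_of_pos (sub_pos.2 hx)]
  · rcases lt_trichotomy x x₁ with h' | rfl | h'
    · rw [Real.sign_of_pos (sub_pos.2 h), Real.sign_of_pos (sub_pos.2 h'), if_pos ⟨h, h'⟩]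
      norm_num
    · simp [Real.sign_of_pos (sub_pos.2 h)]
    · rw [Real.sign_of_pos (sub_pos.2 h), Real.sign_of_neg (sub_neg.2 h'),
        if_neg (fun h'' => h'.not_gt h''.2), if_neg (not_or.2 ⟨h.ne', h'.ne'⟩)]
      norm_num

theorem sign_add_sign_mul_sign_add_sign {x₀ x₁ y₀ y₁ : ℝ} (hx : x₀ < x₁) (hy : y₀ < y₁) {x y : ℝ}
    (hxy : ¬((x = x₀ ∨ x = x₁) ∧ (y = y₀ ∨ y = y₁))) :
    (Real.sign (x - x₀) + Real.sign (x₁ - x)) * (Real.sign (y - y₀) + Real.sign (y₁ - y)) =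
      4 * (if x₀ < x ∧ x < x₁ ∧ y₀ < y ∧ y < y₁ then 1 else 0) +
      2 * (if (x₀ ≤ x ∧ x ≤ x₁ ∧ y₀ ≤ y ∧ y ≤ y₁) ∧
        ¬(x₀ < x ∧ x < x₁ ∧ y₀ < y ∧ y < y₁) then 1 else 0) := by
  rw [sign_add_sign_eq hx, sign_add_sign_eq hy]
  grind

end

/-- Cauchy's root-counting theorem: if the nonzero polynomial `F ∈ ℂ[Z]` does not vanish
at any of the four vertices of the rectangle `Γ = [x₀,x₁] × [y₀,y₁]`, then the algebraic
index along `∂Γ` counts the roots of `F` in `Γ` with multiplicity, roots on the boundary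
counting with half their multiplicity. -/
theorem cauchy_root_counting (F : Polynomial ℂ) (hF : F ≠ 0)
    (x₀ x₁ y₀ y₁ : ℝ) (hx : x₀ < x₁) (hy : y₀ < y₁)
    (hvert : ∀ x ∈ ({x₀, x₁} : Set ℝ), ∀ y ∈ ({y₀, y₁} : Set ℝ),
      F.eval (x + y * Complex.I) ≠ 0) :
    rectIndexC F x₀ x₁ y₀ y₁ =
      (∑ z ∈ F.roots.toFinset,
        if x₀ < z.re ∧ z.re < x₁ ∧ y₀ < z.im ∧ z.im < y₁ then
          (rootMultiplicity z F : ℝ) else 0) +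
      (1 / 2) * (∑ z ∈ F.roots.toFinset,
        if (x₀ ≤ z.re ∧ z.re ≤ x₁ ∧ y₀ ≤ z.im ∧ z.im ≤ y₁) ∧
            ¬(x₀ < z.re ∧ z.re < x₁ ∧ y₀ < z.im ∧ z.im < y₁) then
          (rootMultiplicity z F : ℝ) else 0) := by
  have h₀₀ := hvert x₀ (by simp) y₀ (by simp)
  have h₁₀ := hvert x₁ (by simp) y₀ (by simp)
  have h₁₁ := hvert x₁ (by simp) y₁ (by simp)
  have h₀₁ := hvert x₀ (by simp) y₁ (by simp)
  have hroot : ∀ z ∈ F.roots.toFinset,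
      ¬((z.re = x₀ ∨ z.re = x₁) ∧ (z.im = y₀ ∨ z.im = y₁)) := by
    rintro z hz ⟨hre, him⟩
    refine hvert z.re (by simpa using hre) z.im (by simpa using him) ?_
    rw [Complex.re_add_im]
    exact (mem_roots hF).1 (Multiset.mem_toFinset.1 hz)
  refine mul_left_cancel₀ Real.two_pi_pos.ne' ?_
  have hbot := two_pi_mul_segIndexC_horizontal F hx.ne h₀₀ h₁₀
  have hright := two_pi_mul_segIndexC_vertical F hy.ne h₁₀ h₁₁
  have htop := two_pi_mul_segIndexC_horizontal F hx.ne' h₁₁ h₀₁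
  have hleft := two_pi_mul_segIndexC_vertical F hy.ne' h₀₁ h₀₀
  trans ∑ z ∈ F.roots.toFinset, (rootMultiplicity z F : ℝ) * (Real.pi / 2 *
      ((Real.sign (z.re - x₀) + Real.sign (x₁ - z.re)) *
        (Real.sign (z.im - y₀) + Real.sign (y₁ - z.im))))
  · simp only [← sum_arctan_div]
    simp only [mul_add, Finset.sum_add_distrib] at hbot hright htop hleft ⊢
    have hneg (u v u' v' : ℝ) : (u - u') / (v - v') = (u' - u) / (v' - v) := by
      rw [← neg_sub u' u, ← neg_sub v' v, neg_div_neg_eq]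
    simp only [hneg x₀ _ _ y₁, hneg _ _ x₁ y₁] at htop
    simp only [hneg y₀ x₀, hneg _ x₀ y₁] at hleft
    rw [rectIndexC]
    linear_combination hbot + hright + htop + hleft
  · rw [Finset.mul_sum, ← Finset.sum_add_distrib, Finset.mul_sum]
    refine Finset.sum_congr rfl fun z hz => ?_
    rw [sign_add_sign_mul_sign_add_sign hx hy (hroot z hz)]
    split_ifs <;> ring
end

section
/- Routh–Hurwitz theorem: let F ∈ ℂ[Z] be a nonzero polynomial of degree n, and write F(iY) = R + i·S with R, S ∈ ℝ[Y]. Let R*, S* ∈ ℝ[Y] be the real and imaginary parts of the polynomial Y^n·F(i/Y) (so that R*/S* = R(1/Y)/S(1/Y) as rational functions in Y). Then for every r > 0, −Ind_{−r}^{r}(R/S) + Ind_{−1/r}^{1/r}(R*/S*) = p − q, where p (resp. q) is the number of roots of F in ℂ with positive (resp. negative) real part, each counted with multiplicity. -/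
open Polynomial

namespace RouthHurwitz

open Filter Topology

section Telescoping

/-- A step function with a jump at `x`: value `m` to the left, `0` at `x`, and `p` to the right. -/
noncomputable def step (x m p y : ℝ) : ℝ :=
  if y < x then m else if y = x then 0 else p

/-- A function with prescribed one-sided jumps, all located in a finite set, telescopes. -/
theorem sub_eq_sum_jumps (ψ p m : ℝ → ℝ) (T : Finset ℝ)
    (hpT : ∀ x, x ∉ T → p x = 0) (hmT : ∀ x, x ∉ T → m x = 0)
    (hp : ∀ x, ∀ᶠ y in 𝓝[>] x, ψ y = ψ x + p x)
    (hm : ∀ x, ∀ᶠ y in 𝓝[<] x, ψ y = ψ x + m x) {a b : ℝ} (hab : a < b) :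
    p a + (∑ x ∈ T, if a < x ∧ x < b then p x - m x else 0) - m b = ψ b - ψ a := by
  have sum_right (x : ℝ) : ∀ᶠ y in 𝓝[>] x,
      ∑ t ∈ T, step t (m t) (p t) y = ∑ t ∈ T, step t (m t) (p t) x + p x := by
    have key : ∀ᶠ y in 𝓝[>] x, ∀ t ∈ T, step t (m t) (p t) y =
        step t (m t) (p t) x + if t = x then p x else 0 := by
      rw [eventually_all_finset]
      intro t _
      rcases lt_trichotomy t x with h | h | h
      · filter_upwards [self_mem_nhdsWithin] with y hy
        have hy : x < y := hy
        simp [step, h.ne, h.ne', h.not_gt, (h.trans hy).ne', (h.trans hy).not_gt]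
      · subst h
        filter_upwards [self_mem_nhdsWithin] with y hy
        have hy : t < y := hy
        simp [step, hy.ne', hy.not_gt]
      · filter_upwards [nhdsWithin_le_nhds (Iio_mem_nhds h)] with y hy
        have hy : y < t := hy
        simp [step, h, hy, h.ne']
    filter_upwards [key] with y hy
    rw [Finset.sum_congr rfl hy, Finset.sum_add_distrib, Finset.sum_ite_eq']
    split_ifs with h
    · rfl
    · rw [hpT x h]
  have sum_left (x : ℝ) : ∀ᶠ y in 𝓝[<] x,
      ∑ t ∈ T, step t (m t) (p t) y = ∑ t ∈ T, step t (m t) (p t) x + m x := by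
    have key : ∀ᶠ y in 𝓝[<] x, ∀ t ∈ T, step t (m t) (p t) y =
        step t (m t) (p t) x + if t = x then m x else 0 := by
      rw [eventually_all_finset]
      intro t _
      rcases lt_trichotomy t x with h | h | h
      · filter_upwards [nhdsWithin_le_nhds (Ioi_mem_nhds h)] with y hy
        have hy : t < y := hy
        simp [step, h.ne, h.ne', h.not_gt, hy.ne', hy.not_gt]
      · subst h
        filter_upwards [self_mem_nhdsWithin] with y hy
        have hy : y < t := hy
        simp [step, hy]
      · filter_upwards [self_mem_nhdsWithin] with y hy
        have hy : y < x := hy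
        simp [step, h, hy.trans h, h.ne']
    filter_upwards [key] with y hy
    rw [Finset.sum_congr rfl hy, Finset.sum_add_distrib, Finset.sum_ite_eq']
    split_ifs with h
    · rfl
    · rw [hmT x h]
  have locconst : IsLocallyConstant fun y => ψ y - ∑ t ∈ T, step t (m t) (p t) y := by
    rw [IsLocallyConstant.iff_eventually_eq]
    intro x
    rw [← nhdsNE_sup_pure, ← nhdsLT_sup_nhdsGT]
    simp only [eventually_sup, eventually_pure, and_true]
    constructor
    · filter_upwards [hm x, sum_left x] with y h₁ h₂
      rw [h₁, h₂]; ring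
    · filter_upwards [hp x, sum_right x] with y h₁ h₂
      rw [h₁, h₂]; ring
  have hconst := locconst.apply_eq_of_preconnectedSpace b a
  have hdiff : ψ b - ψ a = ∑ t ∈ T, (step t (m t) (p t) b - step t (m t) (p t) a) := by
    rw [Finset.sum_sub_distrib]; linarith
  have hterm (t : ℝ) : step t (m t) (p t) b - step t (m t) (p t) a =
      (if t = a then p a else 0) + (if a < t ∧ t < b then p t - m t else 0) -
        (if t = b then m b else 0) := by
    rcases lt_trichotomy t a with h | h | h
    · have h' := h.trans hab
      simp [step, h.ne, h.ne', h.not_gt, h'.ne, h'.ne', h'.not_gt]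
    · subst h
      simp [step, hab.ne, hab.ne', hab.not_gt]
    · rcases lt_trichotomy t b with h' | h' | h'
      · simp [step, h, h', h.ne', h'.ne, h'.ne', h'.not_gt]
      · subst h'
        simp [step, h, h.ne']
      · simp [step, h, h', h.ne', h'.ne', h'.not_gt]
  rw [hdiff, Finset.sum_congr rfl fun t _ => hterm t, Finset.sum_sub_distrib,
    Finset.sum_add_distrib, Finset.sum_ite_eq', Finset.sum_ite_eq']
  have ha : (if a ∈ T then p a else 0) = p a := by
    split_ifs with h
    · rfl
    · rw [hpT a h]
  have hb : (if b ∈ T then m b else 0) = m b := by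
    split_ifs with h
    · rfl
    · rw [hmT b h]
  rw [ha, hb]

end Telescoping

section HalfTurns

/-- The number of half turns of an angle, with half weight at multiples of `π`. -/
noncomputable def halfTurns (t : ℝ) : ℝ := (⌊t / Real.pi⌋ + ⌈t / Real.pi⌉) / 2

theorem halfTurns_add_int_mul_pi (t : ℝ) (k : ℤ) :
    halfTurns (t + k * Real.pi) = halfTurns t + k := by
  have h : (t + k * Real.pi) / Real.pi = t / Real.pi + k := by
    field_simp
  simp only [halfTurns, h, Int.floor_add_intCast, Int.ceil_add_intCast]
  push_cast
  ring

theorem halfTurns_of_pos_of_lt_pi {t : ℝ} (h₀ : 0 < t) (h₁ : t < Real.pi) :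
    halfTurns t = 1 / 2 := by
  have hpos : 0 < t / Real.pi := div_pos h₀ Real.pi_pos
  have hlt : t / Real.pi < 1 := (div_lt_one Real.pi_pos).2 h₁
  have hf : ⌊t / Real.pi⌋ = 0 := Int.floor_eq_iff.2 ⟨by simpa using hpos.le, by simpa using hlt⟩
  have hc : ⌈t / Real.pi⌉ = 1 := Int.ceil_eq_iff.2 ⟨by simpa using hpos, by simpa using hlt.le⟩
  simp [halfTurns, hf, hc]

theorem halfTurns_of_abs_lt {t : ℝ} (h₀ : -(Real.pi / 2) < t) (h₁ : t < Real.pi / 2) :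
    halfTurns t = 1 / 2 * Real.sign (Real.sin t * Real.cos t) := by
  have hcos : 0 < Real.cos t := Real.cos_pos_of_mem_Ioo ⟨h₀, h₁⟩
  have hpi := Real.pi_pos
  rcases lt_trichotomy t 0 with h | h | h
  · have hsin := Real.sin_neg_of_neg_of_neg_pi_lt h (by linarith)
    rw [Real.sign_of_neg (mul_neg_of_neg_of_pos hsin hcos)]
    have h := halfTurns_add_int_mul_pi t 1
    rw [halfTurns_of_pos_of_lt_pi (by push_cast; linarith) (by push_cast; linarith)] at h
    push_cast at h
    linarith
  · simp [h, halfTurns]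
  · have hsin := Real.sin_pos_of_pos_of_lt_pi h (by linarith)
    rw [Real.sign_of_pos (mul_pos hsin hcos), halfTurns_of_pos_of_lt_pi h (by linarith)]
    ring

/-- Near a multiple of `π`, `halfTurns` is governed by the sign of `sin * cos`. -/
theorem eventually_halfTurns_of_sin_eq_zero {t : ℝ} (ht : Real.sin t = 0) :
    ∀ᶠ s in 𝓝 t, halfTurns s = halfTurns t + 1 / 2 * Real.sign (Real.sin s * Real.cos s) := by
  obtain ⟨k, rfl⟩ := Real.sin_eq_zero_iff.1 ht
  have hpi := Real.pi_pos
  filter_upwards [Ioo_mem_nhds (show (k : ℝ) * Real.pi - Real.pi / 2 < k * Real.pi by linarith)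
    (show (k : ℝ) * Real.pi < k * Real.pi + Real.pi / 2 by linarith)] with s hs
  have hs' : s = (s - k * Real.pi) + k * Real.pi := by ring
  have hk : halfTurns (k * Real.pi) = k := by
    have h₀ : halfTurns 0 = 0 := by simp [halfTurns]
    simpa [h₀] using halfTurns_add_int_mul_pi 0 k
  have hsc : Real.sin s * Real.cos s =
      Real.sin (s - k * Real.pi) * Real.cos (s - k * Real.pi) := by
    have h₁ := Real.sin_two_mul s
    have h₂ := Real.sin_two_mul (s - k * Real.pi)
    have h₃ : Real.sin (2 * (s - k * Real.pi)) = Real.sin (2 * s) := by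
      rw [show 2 * (s - k * Real.pi) = 2 * s - k * (2 * Real.pi) by ring,
        Real.sin_sub_int_mul_two_pi]
    linarith
  rw [hsc, ← halfTurns_of_abs_lt (by linarith [hs.1]) (by linarith [hs.2]), hk]
  conv_lhs => rw [hs', halfTurns_add_int_mul_pi]
  ring

/-- Away from the multiples of `π`, `halfTurns` is locally constant. -/
theorem eventually_halfTurns_of_sin_ne_zero {t : ℝ} (ht : Real.sin t ≠ 0) :
    ∀ᶠ s in 𝓝 t, halfTurns s = halfTurns t := by
  have hpi := Real.pi_pos
  set k : ℤ := ⌊t / Real.pi⌋ with hk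
  have h₁ : (k : ℝ) * Real.pi ≤ t := (le_div_iff₀ hpi).1 (Int.floor_le _)
  have h₂ : t < (k + 1) * Real.pi := (div_lt_iff₀ hpi).1 (Int.lt_floor_add_one _)
  have h₃ : (k : ℝ) * Real.pi < t :=
    lt_of_le_of_ne h₁ fun h => ht (h ▸ Real.sin_int_mul_pi k)
  have key {s : ℝ} (hs : s ∈ Set.Ioo ((k : ℝ) * Real.pi) ((k + 1) * Real.pi)) :
      halfTurns s = 1 / 2 + k := by
    rw [← halfTurns_of_pos_of_lt_pi (t := s - k * Real.pi) (by linarith [hs.1])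
      (by linarith [hs.2]), ← halfTurns_add_int_mul_pi]
    ring_nf
  filter_upwards [Ioo_mem_nhds h₃ h₂] with s hs
  rw [key hs, key ⟨h₃, h₂⟩]

end HalfTurns

section LocalIndex

theorem unitEval_ne_zero {P : ℝ[X]} (hP : P ≠ 0) (x : ℝ) : unitEval P x ≠ 0 :=
  eval_divByMonic_pow_rootMultiplicity_ne_zero x hP

theorem eval_eq_pow_rootMultiplicity_mul (P : ℝ[X]) (x y : ℝ) :
    P.eval y = (y - x) ^ rootMultiplicity x P *
      (P /ₘ (X - C x) ^ rootMultiplicity x P).eval y := by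
  conv_lhs => rw [← pow_mul_divByMonic_rootMultiplicity_eq P x]
  simp

theorem eventually_sign_unit {P : ℝ[X]} (hP : P ≠ 0) (x : ℝ) :
    ∀ᶠ y in 𝓝 x, Real.sign ((P /ₘ (X - C x) ^ rootMultiplicity x P).eval y) =
      Real.sign (unitEval P x) := by
  have hc := (P /ₘ (X - C x) ^ rootMultiplicity x P).continuous.continuousAt (x := x)
  rcases (unitEval_ne_zero hP x).lt_or_gt with h | h
  · filter_upwards [hc.eventually_lt_const h] with y hy
    rw [Real.sign_of_neg hy, Real.sign_of_neg h]
  · filter_upwards [hc.eventually_const_lt h] with y hy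
    rw [Real.sign_of_pos hy, Real.sign_of_pos h]

theorem real_sign_mul (a b : ℝ) : Real.sign (a * b) = Real.sign a * Real.sign b := by
  rcases lt_trichotomy a 0 with ha | ha | ha <;> rcases lt_trichotomy b 0 with hb | hb | hb <;>
    simp [*, Real.sign_of_neg, Real.sign_of_pos, mul_pos_of_neg_of_neg, mul_neg_of_neg_of_pos,
      mul_neg_of_pos_of_neg]

theorem real_sign_pow (a : ℝ) (n : ℕ) : Real.sign (a ^ n) = Real.sign a ^ n := by
  induction n with
  | zero => simp [Real.sign_of_pos]
  | succ n ih => rw [pow_succ, pow_succ, real_sign_mul, ih]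

theorem eventually_sign_mul {R S : ℝ[X]} (hR : R ≠ 0) (hS : S ≠ 0) (x : ℝ) :
    ∀ᶠ y in 𝓝 x, Real.sign (R.eval y * S.eval y) =
      Real.sign (y - x) ^ (rootMultiplicity x R + rootMultiplicity x S) *
        Real.sign (unitEval R x * unitEval S x) := by
  filter_upwards [eventually_sign_unit hR x, eventually_sign_unit hS x] with y h₁ h₂
  rw [eval_eq_pow_rootMultiplicity_mul R x y, eval_eq_pow_rootMultiplicity_mul S x y]
  simp only [real_sign_mul, real_sign_pow, h₁, h₂, pow_add]
  ring

theorem sign_sin_mul_cos {u v t : ℝ} (hu : u ≠ 0) (h : u * Real.sin t = v * Real.cos t) :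
    Real.sign (Real.sin t * Real.cos t) = Real.sign (u * v) := by
  have key : u * v = (u ^ 2 + v ^ 2) * (Real.sin t * Real.cos t) := by
    linear_combination (-(u * v)) * Real.sin_sq_add_cos_sq t - u * Real.cos t * h
      + v * Real.sin t * h
  have hpos : 0 < u ^ 2 + v ^ 2 := by positivity
  rw [key, real_sign_mul (_ + _), Real.sign_of_pos hpos, one_mul]

variable {R S : ℝ[X]} {θ : ℝ → ℝ}

theorem eq_of_eq_off_point {f g : ℝ → ℝ} (hf : Continuous f) (hg : Continuous g) {x : ℝ}
    (h : ∀ y, y ≠ x → f y = g y) : f = g :=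
  hf.ext_on (dense_compl_singleton x) hg h

theorem sin_eq_zero_of_lt (hθ : Continuous θ)
    (h : ∀ y, R.eval y * Real.sin (θ y) = S.eval y * Real.cos (θ y)) (hR : R ≠ 0) {x : ℝ}
    (hlt : rootMultiplicity x R < rootMultiplicity x S) : Real.sin (θ x) = 0 := by
  obtain ⟨d, hd⟩ := Nat.exists_eq_add_of_lt hlt
  have := congrFun (eq_of_eq_off_point (x := x)
    (f := fun y => (R /ₘ (X - C x) ^ rootMultiplicity x R).eval y * Real.sin (θ y))
    (g := fun y => (y - x) ^ (d + 1) *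
      (S /ₘ (X - C x) ^ rootMultiplicity x S).eval y * Real.cos (θ y))
    (by fun_prop) (by fun_prop) fun y hy => by
      have h' := h y
      rw [eval_eq_pow_rootMultiplicity_mul R x y, eval_eq_pow_rootMultiplicity_mul S x y] at h'
      refine mul_left_cancel₀ (pow_ne_zero (rootMultiplicity x R) (sub_ne_zero.2 hy)) ?_
      calc _ = _ := (mul_assoc _ _ _).symm
        _ = _ := h'
        _ = _ := by
          nth_rewrite 1 [hd]
          ring) x
  simp only [sub_self, ne_eq, Nat.add_eq_zero_iff, one_ne_zero, and_false, not_false_eq_true,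
    zero_pow, zero_mul, mul_eq_zero] at this
  exact this.resolve_left (unitEval_ne_zero hR x)

theorem sin_ne_zero_of_le (hθ : Continuous θ)
    (h : ∀ y, R.eval y * Real.sin (θ y) = S.eval y * Real.cos (θ y)) (hS : S ≠ 0) {x : ℝ}
    (hle : rootMultiplicity x S ≤ rootMultiplicity x R) : Real.sin (θ x) ≠ 0 := by
  obtain ⟨d, hd⟩ := Nat.exists_eq_add_of_le hle
  have := congrFun (eq_of_eq_off_point (x := x)
    (f := fun y => (y - x) ^ d *
      (R /ₘ (X - C x) ^ rootMultiplicity x R).eval y * Real.sin (θ y))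
    (g := fun y => (S /ₘ (X - C x) ^ rootMultiplicity x S).eval y * Real.cos (θ y))
    (by fun_prop) (by fun_prop) fun y hy => by
      have h' := h y
      rw [eval_eq_pow_rootMultiplicity_mul R x y, eval_eq_pow_rootMultiplicity_mul S x y] at h'
      refine mul_left_cancel₀ (pow_ne_zero (rootMultiplicity x S) (sub_ne_zero.2 hy)) ?_
      calc _ = _ := by
            rw [← mul_assoc, ← mul_assoc, ← pow_add, ← hd]
        _ = _ := h'
        _ = _ := mul_assoc _ _ _) x
  intro h0
  simp only [h0, mul_zero] at this
  have hcos := (mul_eq_zero.1 this.symm).resolve_left (unitEval_ne_zero hS x)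
  have := Real.sin_sq_add_cos_sq (θ x)
  simp [h0, hcos] at this

theorem eventually_halfTurns_right (hθ : Continuous θ)
    (h : ∀ y, R.eval y * Real.sin (θ y) = S.eval y * Real.cos (θ y))
    (hR : R ≠ 0) (hS : S ≠ 0) (x : ℝ) :
    ∀ᶠ y in 𝓝[>] x, halfTurns (θ y) = halfTurns (θ x) + indPlus R S x := by
  have hθx := hθ.tendsto x
  unfold indPlus
  split_ifs with hlt
  · have hsin := sin_eq_zero_of_lt hθ h hR (by exact_mod_cast hlt)
    filter_upwards [nhdsWithin_le_nhds (hθx.eventually (eventually_halfTurns_of_sin_eq_zero hsin)),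
      nhdsWithin_le_nhds (eventually_sign_mul hR hS x), self_mem_nhdsWithin,
      (eventually_nhdsWithin_of_eventually_nhds (eventually_sign_unit hR x))] with y h₁ h₂ hy h₃
    have hy : x < y := hy
    have hRy : R.eval y ≠ 0 := by
      rw [eval_eq_pow_rootMultiplicity_mul R x y]
      refine mul_ne_zero (pow_ne_zero _ (sub_ne_zero.2 hy.ne')) fun h0 => ?_
      rw [h0, Real.sign_zero, eq_comm, Real.sign_eq_zero_iff] at h₃
      exact unitEval_ne_zero hR x h₃
    rw [h₁, sign_sin_mul_cos hRy (h y), h₂, Real.sign_of_pos (sub_pos.2 hy), one_pow, one_mul]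
  · have hsin := sin_ne_zero_of_le hθ h hS (x := x) (by exact_mod_cast not_lt.1 hlt)
    rw [add_zero]
    exact nhdsWithin_le_nhds (hθx.eventually (eventually_halfTurns_of_sin_ne_zero hsin))

theorem eventually_halfTurns_left (hθ : Continuous θ)
    (h : ∀ y, R.eval y * Real.sin (θ y) = S.eval y * Real.cos (θ y))
    (hR : R ≠ 0) (hS : S ≠ 0) (x : ℝ) :
    ∀ᶠ y in 𝓝[<] x, halfTurns (θ y) = halfTurns (θ x) + indMinus R S x := by
  have hθx := hθ.tendsto x
  unfold indMinus
  split_ifs with hlt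
  · have hlt : rootMultiplicity x R < rootMultiplicity x S := by exact_mod_cast hlt
    have hsin := sin_eq_zero_of_lt hθ h hR hlt
    filter_upwards [nhdsWithin_le_nhds (hθx.eventually (eventually_halfTurns_of_sin_eq_zero hsin)),
      nhdsWithin_le_nhds (eventually_sign_mul hR hS x), self_mem_nhdsWithin,
      (eventually_nhdsWithin_of_eventually_nhds (eventually_sign_unit hR x))] with y h₁ h₂ hy h₃
    have hy : y < x := hy
    have hRy : R.eval y ≠ 0 := by
      rw [eval_eq_pow_rootMultiplicity_mul R x y]
      refine mul_ne_zero (pow_ne_zero _ (sub_ne_zero.2 hy.ne)) fun h0 => ?_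
      rw [h0, Real.sign_zero, eq_comm, Real.sign_eq_zero_iff] at h₃
      exact unitEval_ne_zero hR x h₃
    have hpow : (-1 : ℝ) ^ (rootMultiplicity x R + rootMultiplicity x S) =
        (-1) ^ (rootMultiplicity x S - rootMultiplicity x R) := by
      rw [show rootMultiplicity x R + rootMultiplicity x S =
        (rootMultiplicity x S - rootMultiplicity x R) + 2 * rootMultiplicity x R by omega,
        pow_add, pow_mul]
      simp
    rw [h₁, sign_sin_mul_cos hRy (h y), h₂, Real.sign_of_neg (sub_neg.2 hy), hpow, mul_assoc]
  · have hsin := sin_ne_zero_of_le hθ h hS (x := x) (by exact_mod_cast not_lt.1 hlt)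
    rw [add_zero]
    exact nhdsWithin_le_nhds (hθx.eventually (eventually_halfTurns_of_sin_ne_zero hsin))

theorem eq_zero_of_eval_mul_eq_zero {P : ℝ[X]} (hP : P ≠ 0) {f : ℝ → ℝ} (hf : Continuous f)
    (h : ∀ y, P.eval y * f y = 0) : f = 0 := by
  refine hf.ext_on (s := {y | y ∈ P.roots.toFinset}ᶜ) ?_ continuous_const fun y hy => ?_
  · exact (Finset.countable_toSet P.roots.toFinset).dense_compl ℝ
  · refine (mul_eq_zero.1 (h y)).resolve_left fun h0 => hy ?_
    simpa [hP] using h0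

/-- The Cauchy index of `R/S` counts the half turns made by any continuous argument of
`R + i S`. -/
theorem cauchyIndex_eq_halfTurns (hθ : Continuous θ)
    (h : ∀ y, R.eval y * Real.sin (θ y) = S.eval y * Real.cos (θ y))
    (hRS : R ≠ 0 ∨ S ≠ 0) {a b : ℝ} (hab : a < b) :
    cauchyIndex R S a b = halfTurns (θ b) - halfTurns (θ a) := by
  have hconst (hloc : ∀ x, ∀ᶠ y in 𝓝 x, halfTurns (θ y) = halfTurns (θ x)) :
      0 = halfTurns (θ b) - halfTurns (θ a) := by
    have := ((IsLocallyConstant.iff_eventually_eq (halfTurns ∘ θ)).2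
      hloc).apply_eq_of_preconnectedSpace b a
    simp only [Function.comp_apply] at this
    rw [this, sub_self]
  unfold cauchyIndex
  split_ifs with h0
  · refine hconst fun x => ?_
    rcases h0 with rfl | rfl
    · have hcos := congrFun (eq_zero_of_eval_mul_eq_zero (f := fun y => Real.cos (θ y))
        (hRS.resolve_left (not_not.2 rfl)) (by fun_prop) fun y => by simpa using (h y).symm)
      refine (hθ.tendsto x).eventually (eventually_halfTurns_of_sin_ne_zero fun hsin => ?_)
      have := Real.sin_sq_add_cos_sq (θ x)
      simp [hsin, show Real.cos (θ x) = 0 from hcos x] at this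
    · have hsin := congrFun (eq_zero_of_eval_mul_eq_zero (f := fun y => Real.sin (θ y))
        (hRS.resolve_right (not_not.2 rfl)) (by fun_prop) fun y => by simpa using h y)
      filter_upwards [(hθ.tendsto x).eventually
        (eventually_halfTurns_of_sin_eq_zero (hsin x))] with y hy
      rw [hy, show Real.sin (θ y) = 0 from hsin y]
      simp
  · rw [not_or] at h0
    have hmult (x : ℝ) (hx : x ∉ S.roots.toFinset) : rootMultiplicity x S = 0 := by
      rw [← count_roots, Multiset.count_eq_zero]
      simpa using hx
    exact sub_eq_sum_jumps (fun y => halfTurns (θ y)) (indPlus R S) (indMinus R S)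
      S.roots.toFinset (fun x hx => by simp [indPlus, hmult x hx])
      (fun x hx => by simp [indMinus, hmult x hx])
      (eventually_halfTurns_right hθ h h0.1 h0.2) (eventually_halfTurns_left hθ h h0.1 h0.2) hab

end LocalIndex

section Argument

open Complex

/-- `z` is a real multiple of `exp (i t)`. -/
def HasDirection (z : ℂ) (t : ℝ) : Prop := ∃ ρ : ℝ, z = ρ * exp (t * I)

theorem HasDirection.mul {z w : ℂ} {s t : ℝ} (hz : HasDirection z s) (hw : HasDirection w t) :
    HasDirection (z * w) (s + t) := by
  obtain ⟨a, rfl⟩ := hz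
  obtain ⟨b, rfl⟩ := hw
  refine ⟨a * b, ?_⟩
  push_cast
  rw [add_mul, exp_add]
  ring

theorem hasDirection_arg (z : ℂ) : HasDirection z z.arg := ⟨‖z‖, (norm_mul_exp_arg_mul_I z).symm⟩

theorem HasDirection.ofReal_mul {z : ℂ} {t : ℝ} (h : HasDirection z t) (a : ℝ) :
    HasDirection (a * z) t := by
  obtain ⟨b, rfl⟩ := h
  exact ⟨a * b, by push_cast; ring⟩

theorem hasDirection_I : HasDirection I (Real.pi / 2) := by
  simpa using hasDirection_arg I

theorem HasDirection.re_mul_sin {z : ℂ} {t : ℝ} (h : HasDirection z t) :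
    z.re * Real.sin t = z.im * Real.cos t := by
  obtain ⟨ρ, rfl⟩ := h
  rw [re_ofReal_mul, im_ofReal_mul, exp_ofReal_mul_I_re, exp_ofReal_mul_I_im]
  ring

theorem arg_I_mul {w : ℂ} (hw : 0 < w.re) : arg (I * w) = arg w + Real.pi / 2 := by
  have h := abs_lt.1 (abs_arg_lt_pi_div_two_iff.2 (Or.inl hw))
  rw [arg_mul I_ne_zero (by rintro rfl; simp at hw), arg_I, add_comm]
  rw [arg_I]
  exact ⟨by linarith [Real.pi_pos], by linarith⟩

theorem arg_neg_I_mul {w : ℂ} (hw : 0 < w.re) : arg (-I * w) = arg w - Real.pi / 2 := by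
  have h := abs_lt.1 (abs_arg_lt_pi_div_two_iff.2 (Or.inl hw))
  rw [arg_mul (neg_ne_zero.2 I_ne_zero) (by rintro rfl; simp at hw), arg_neg_I]
  · ring
  rw [arg_neg_I]
  exact ⟨by linarith [Real.pi_pos], by linarith⟩

/-- The contribution of the half plane containing `z` to the Routh–Hurwitz count. -/
noncomputable def halfPlaneSign (z : ℂ) : ℤ :=
  (if 0 < z.re then 1 else 0) - (if z.re < 0 then 1 else 0)

theorem exists_arguments_linear (z : ℂ) {r : ℝ} (hr : 0 < r) :
    ∃ α β : ℝ → ℝ, Continuous α ∧ Continuous β ∧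
      (∀ y : ℝ, HasDirection (I * y - z) (α y)) ∧
      (∀ u : ℝ, HasDirection (I - u * z) (β u)) ∧
      ∃ k : ℤ, β (1 / r) = α r + k * Real.pi ∧
        β (-(1 / r)) = α (-r) + (k - halfPlaneSign z : ℤ) * Real.pi := by
  have hr' : (r : ℂ) ≠ 0 := ofReal_ne_zero.2 hr.ne'
  have hI : I ^ 2 = -1 := I_sq
  have hβdir (u : ℝ) : HasDirection (I - u * z) (Real.pi / 2 + arg (1 + I * u * z)) := by
    convert hasDirection_I.mul (hasDirection_arg (1 + I * u * z)) using 1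
    linear_combination (-(u : ℂ) * z) * hI
  have hβcont (hz : z.re ≠ 0) :
      Continuous fun u : ℝ => Real.pi / 2 + arg (1 + I * u * z) := by
    refine continuous_const.add (continuous_iff_continuousAt.2 fun u => ?_)
    refine ContinuousAt.comp (f := fun u : ℝ => 1 + I * u * z) (continuousAt_arg ?_)
      (by fun_prop)
    rw [mem_slitPlane_iff]
    by_cases hu : u = 0
    · left; simp [hu]
    · right; simp [hu, hz]
  have hplus (w : ℂ) : arg (1 + I * ((1 / r : ℝ) : ℂ) * w) = arg (r + I * w) := by
    rw [← arg_real_mul (r + I * w) (inv_pos.2 hr)]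
    congr 1
    push_cast
    field_simp
  have hminus (w : ℂ) : arg (1 + I * ((-(1 / r) : ℝ) : ℂ) * w) = arg (r - I * w) := by
    rw [← arg_real_mul (r - I * w) (inv_pos.2 hr)]
    congr 1
    push_cast
    field_simp
    ring
  rcases lt_trichotomy z.re 0 with hz | hz | hz
  · refine ⟨fun y => arg (I * y - z), _, ?_, hβcont hz.ne, fun y => hasDirection_arg _, hβdir,
      0, ?_, ?_⟩
    · refine continuous_iff_continuousAt.2 fun y => ?_
      exact ContinuousAt.comp (f := fun y : ℝ => I * y - z)
        (continuousAt_arg (mem_slitPlane_iff.2 (Or.inl (by simpa using hz)))) (by fun_prop)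
    · rw [hplus, show (r : ℂ) + I * z = -I * (I * r - z) by linear_combination (r : ℂ) * hI,
        arg_neg_I_mul (by simpa using hz)]
      push_cast
      ring
    · rw [hminus, show (r : ℂ) - I * z = I * (I * (-r : ℝ) - z) by
          push_cast; linear_combination (r : ℂ) * hI,
        arg_I_mul (by simpa using hz)]
      simp only [halfPlaneSign, hz, hz.not_gt, if_true, if_false]
      push_cast
      ring
  · refine ⟨fun _ => Real.pi / 2, fun _ => Real.pi / 2, continuous_const, continuous_const,
      fun y => ?_, fun u => ?_, 0, by simp, by simp [halfPlaneSign, hz]⟩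
    · convert hasDirection_I.ofReal_mul (y - z.im) using 1
      apply Complex.ext <;> simp [hz]
    · convert hasDirection_I.ofReal_mul (1 - u * z.im) using 1
      apply Complex.ext <;> simp [hz]
  · refine ⟨fun y => arg (z - I * y), _, ?_, hβcont hz.ne', fun y => ?_, hβdir, 1, ?_, ?_⟩
    · refine continuous_iff_continuousAt.2 fun y => ?_
      exact ContinuousAt.comp (f := fun y : ℝ => z - I * y)
        (continuousAt_arg (mem_slitPlane_iff.2 (Or.inl (by simpa using hz)))) (by fun_prop)
    · convert (hasDirection_arg (z - I * y)).ofReal_mul (-1) using 1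
      push_cast
      ring
    · rw [hplus, show (r : ℂ) + I * z = I * (z - I * r) by linear_combination (r : ℂ) * hI,
        arg_I_mul (by simpa using hz)]
      push_cast
      ring
    · rw [hminus, show (r : ℂ) - I * z = -I * (z - I * (-r : ℝ)) by
          push_cast; linear_combination (r : ℂ) * hI,
        arg_neg_I_mul (by simpa using hz)]
      simp only [halfPlaneSign, hz, hz.not_gt, if_true, if_false]
      push_cast
      ring

theorem exists_arguments_prod (s : Multiset ℂ) (c : ℂ) {r : ℝ} (hr : 0 < r) :
    ∃ α β : ℝ → ℝ, Continuous α ∧ Continuous β ∧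
      (∀ y : ℝ, HasDirection (c * (s.map fun z => I * y - z).prod) (α y)) ∧
      (∀ u : ℝ, HasDirection (c * (s.map fun z => I - u * z).prod) (β u)) ∧
      ∃ k : ℤ, β (1 / r) = α r + k * Real.pi ∧
        β (-(1 / r)) = α (-r) + (k - (s.map halfPlaneSign).sum : ℤ) * Real.pi := by
  induction s using Multiset.induction_on with
  | empty =>
    exact ⟨fun _ => arg c, fun _ => arg c, continuous_const, continuous_const,
      fun y => by simpa using hasDirection_arg c, fun u => by simpa using hasDirection_arg c,
      0, by simp, by simp⟩
  | cons z s ih =>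
    obtain ⟨α, β, hα, hβ, h₁, h₂, k, hk, hk'⟩ := ih
    obtain ⟨α', β', hα', hβ', h₁', h₂', l, hl, hl'⟩ := exists_arguments_linear z hr
    refine ⟨fun y => α' y + α y, fun u => β' u + β u, by fun_prop, by fun_prop, fun y => ?_,
      fun u => ?_, k + l, ?_, ?_⟩
    · convert (h₁' y).mul (h₁ y) using 1
      rw [Multiset.map_cons, Multiset.prod_cons]
      ring
    · convert (h₂' u).mul (h₂ u) using 1
      rw [Multiset.map_cons, Multiset.prod_cons]
      ring
    · simp only [hk, hl]
      push_cast
      ring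
    · simp only [hk', hl', Multiset.map_cons, Multiset.sum_cons]
      push_cast
      ring

theorem sum_halfPlaneSign (s : Multiset ℂ) :
    (s.map halfPlaneSign).sum =
      ((s.filter fun z => 0 < z.re).card : ℤ) - ((s.filter fun z => z.re < 0).card : ℤ) := by
  induction s using Multiset.induction_on with
  | empty => simp
  | cons z s ih =>
    rw [Multiset.map_cons, Multiset.sum_cons, ih, Multiset.filter_cons, Multiset.filter_cons,
      Multiset.card_add, Multiset.card_add, halfPlaneSign]
    split_ifs <;> simp <;> ring

end Argument

section RealImaginaryParts

theorem eval_rePoly (p : ℂ[X]) (y : ℝ) : (rePoly p).eval y = (p.eval (y : ℂ)).re := by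
  rw [rePoly, Polynomial.sum, eval_finsetSum, eval_eq_sum, Polynomial.sum,
    Complex.re_sum]
  refine Finset.sum_congr rfl fun k _ => ?_
  rw [eval_mul, eval_C, eval_pow, eval_X, ← Complex.ofReal_pow, Complex.re_mul_ofReal]

theorem eval_imPoly (p : ℂ[X]) (y : ℝ) : (imPoly p).eval y = (p.eval (y : ℂ)).im := by
  rw [imPoly, Polynomial.sum, eval_finsetSum, eval_eq_sum, Polynomial.sum,
    Complex.im_sum]
  refine Finset.sum_congr rfl fun k _ => ?_
  rw [eval_mul, eval_C, eval_pow, eval_X, ← Complex.ofReal_pow, Complex.im_mul_ofReal]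

theorem rePoly_ne_zero_or_imPoly_ne_zero {p : ℂ[X]} (hp : p ≠ 0) :
    rePoly p ≠ 0 ∨ imPoly p ≠ 0 := by
  by_contra! h
  refine hp (eq_zero_of_infinite_isRoot p
    ((Set.infinite_range_of_injective Complex.ofReal_injective).mono ?_))
  rintro _ ⟨y, rfl⟩
  apply Complex.ext
  · simpa [h.1] using (eval_rePoly p y).symm
  · simpa [h.2] using (eval_imPoly p y).symm

/-- The Cauchy index of `Re G / Im G` in terms of a continuous argument of `G`. -/
theorem cauchyIndex_rePoly_imPoly {G : ℂ[X]} (hG : G ≠ 0) {θ : ℝ → ℝ} (hθ : Continuous θ)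
    (h : ∀ y : ℝ, HasDirection (G.eval (y : ℂ)) (θ y)) {a b : ℝ} (hab : a < b) :
    cauchyIndex (rePoly G) (imPoly G) a b = halfTurns (θ b) - halfTurns (θ a) := by
  refine cauchyIndex_eq_halfTurns hθ (fun y => ?_) (rePoly_ne_zero_or_imPoly_ne_zero hG) hab
  rw [eval_rePoly, eval_imPoly]
  exact (h y).re_mul_sin

theorem eval_eq_leadingCoeff_mul_prod (F : ℂ[X]) (w : ℂ) :
    F.eval w = F.leadingCoeff * (F.roots.map fun z => w - z).prod := by
  conv_lhs => rw [(IsAlgClosed.splits F).eq_prod_roots]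
  simp [eval_multiset_prod, Multiset.map_map]

theorem eval_homogenized (F : ℂ[X]) (w u : ℂ) :
    (∑ k ∈ Finset.range (F.natDegree + 1),
      C (F.coeff k * w ^ k) * X ^ (F.natDegree - k)).eval u =
      F.leadingCoeff * (F.roots.map fun z => w - u * z).prod := by
  have hcard : F.roots.card = F.natDegree := (IsAlgClosed.splits F).natDegree_eq_card_roots.symm
  rw [eval_finsetSum]
  by_cases hu : u = 0
  · subst hu
    rw [Finset.sum_range_succ, Finset.sum_eq_zero fun k hk => ?_]
    · simp [hcard]
    · have : F.natDegree - k ≠ 0 := by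
        have := Finset.mem_range.1 hk
        omega
      simp [this]
  · have hprod : (F.roots.map fun z => w - u * z).prod =
        u ^ F.natDegree * (F.roots.map fun z => w / u - z).prod := by
      rw [← hcard, ← Multiset.prod_replicate, ← Multiset.map_const', ← Multiset.prod_map_mul]
      congr 1
      refine Multiset.map_congr rfl fun z _ => ?_
      field_simp
    rw [hprod, mul_left_comm, ← eval_eq_leadingCoeff_mul_prod, eval_eq_sum_range, Finset.mul_sum]
    refine Finset.sum_congr rfl fun k hk => ?_
    have hk : k ≤ F.natDegree := Nat.lt_succ_iff.1 (Finset.mem_range.1 hk)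
    have : u ^ F.natDegree = u ^ (F.natDegree - k) * u ^ k := by
      rw [← pow_add, Nat.sub_add_cancel hk]
    rw [eval_mul, eval_C, eval_pow, eval_X, this, div_pow]
    field_simp

end RealImaginaryParts

end RouthHurwitz

open RouthHurwitz


/-- Routh–Hurwitz theorem: let `F ∈ ℂ[Z]` be a nonzero polynomial of degree `n`, write
`F(iY) = R + iS` with `R, S ∈ ℝ[Y]`, and let `R* + iS* = Y^n · F(i/Y)`, i.e. the
polynomial `Σ_k c_k i^k Y^{n-k}` when `F = Σ_k c_k Z^k`.  Then for every `r > 0`,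
`-Ind_{-r}^{r}(R/S) + Ind_{-1/r}^{1/r}(R*/S*) = p - q`, where `p` (resp. `q`) is the
number of roots of `F` with positive (resp. negative) real part, counted with
multiplicity. -/
theorem routh_hurwitz (F : Polynomial ℂ) (hF : F ≠ 0) (n : ℕ) (hn : F.natDegree = n)
    (G Gstar : Polynomial ℂ)
    (hG : G = F.comp (Polynomial.C Complex.I * Polynomial.X))
    (hGstar : Gstar = ∑ k ∈ Finset.range (n + 1),
      Polynomial.C (F.coeff k * Complex.I ^ k) * Polynomial.X ^ (n - k)) :
    ∀ r : ℝ, 0 < r →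
      -(cauchyIndex (rePoly G) (imPoly G) (-r) r) +
        cauchyIndex (rePoly Gstar) (imPoly Gstar) (-(1 / r)) (1 / r) =
      ((F.roots.filter fun z => 0 < z.re).card : ℝ) -
      ((F.roots.filter fun z => z.re < 0).card : ℝ) := by
  intro r hr
  subst hn
  obtain ⟨α, β, hα, hβ, hGα, hGβ, k, hk, hk'⟩ :=
    exists_arguments_prod F.roots F.leadingCoeff hr
  have hG0 : G ≠ 0 := by
    rw [hG, Ne, comp_C_mul_X_eq_zero_iff (by simp)]
    exact hF
  have hGstar0 : Gstar ≠ 0 := by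
    rintro rfl
    have h := eval_homogenized F Complex.I 0
    rw [← hGstar] at h
    simp [hF] at h
  rw [cauchyIndex_rePoly_imPoly hG0 hα
      (fun y => by
        rw [hG, eval_comp, eval_eq_leadingCoeff_mul_prod]
        simpa using hGα y) (by linarith),
    cauchyIndex_rePoly_imPoly hGstar0 hβ
      (fun u => by
        rw [hGstar, eval_homogenized]
        exact hGβ u) (by have := one_div_pos.2 hr; linarith),
    hk, hk', halfTurns_add_int_mul_pi, halfTurns_add_int_mul_pi, sum_halfPlaneSign]
  push_cast
  ring
end
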